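/- arXiv:1905.12816 — 2 statements merged into one kernel-verified Lean document; each statement's English description precedes it below -/
import Mathlib

section
/- There exists an absolute constant $C > 0$ (independent of $r$, $a$, $b$, and $d$) such that for every interval $I = (a,b)$ and every vector-valued polynomial $\phi : (a,b) \to \mathbb{R}^d$ of degree at most $r$, $\|\phi\|_{L^\infty(I)}^2 \le C \log(r+1) \int_a^b |\phi'(t)|^2 (t-a)\,dt + C |\phi(b)|^2$. -/
open Polynomial in
lemma aux_growth {n : ℕ} (hn : 1 ≤ n) (P : ℝ[X]) (hP : P.degree ≤ (n : ℕ)) (a b c M : ℝ)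
    (hab : a < b) (hc : c = a + (b - a) / (8 * (n:ℝ)^2)) (hM : 0 < M)
    (hb : ∀ t ∈ Set.Icc c b, |P.eval t| ≤ M) (x : ℝ) (hx : a ≤ x) (hxc : x ≤ c) :
    |P.eval x| ≤ 3 * M := by
  have hn1 : (1:ℝ) ≤ n := by exact_mod_cast hn
  obtain ⟨e, he⟩ : ∃ e : ℝ, e = 1 / (8 * (n:ℝ)^2) := ⟨_, rfl⟩
  have he0 : 0 < e := by rw [he]; positivity
  have he1 : e ≤ 1 / 8 := by
    rw [he]; apply one_div_le_one_div_of_le <;> nlinarith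
  have hc' : c = a + (b - a) * e := by rw [hc, he]; ring
  have hcb : 0 < b - c := by rw [hc']; nlinarith
  obtain ⟨y, hy⟩ : ∃ y : ℝ, y = (b + c - 2 * x) / (b - c) := ⟨_, rfl⟩
  have hyx : (b + c) / 2 - (b - c) / 2 * y = x := by rw [hy]; field_simp; ring
  have hy1 : 1 ≤ y := by rw [hy, le_div_iff₀ hcb]; linarith
  have hy2 : y ≤ 1 + 4 * e := by
    rw [hy, div_le_iff₀ hcb, hc']
    nlinarith [mul_nonneg (mul_pos (sub_pos.2 hab) he0).le (by linarith : 0 ≤ 1 - 2 * e)]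
  have hcosh : 1 + 4 * e ≤ Real.cosh (1 / n) := by
    have h1 : Real.cosh (1 / n) = 1 + 2 * Real.sinh (1 / (2 * n)) ^ 2 := by
      have : (1:ℝ) / n = 2 * (1 / (2 * n)) := by field_simp
      rw [this, Real.cosh_two_mul, Real.cosh_sq]; ring
    have h2 : (1:ℝ) / (2 * n) ≤ Real.sinh (1 / (2 * n)) :=
      Real.self_le_sinh_iff.2 (by positivity)
    have h3 : ((1:ℝ) / (2 * n))^2 ≤ Real.sinh (1 / (2 * n)) ^ 2 := by gcongr
    have h4 : 4 * e = 2 * ((1:ℝ) / (2 * n))^2 := by rw [he]; field_simp; norm_num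
    linarith
  have hT : (Chebyshev.T ℝ n).eval y ≤ 3 := by
    rw [← Real.cosh_arcosh hy1, Chebyshev.T_real_cosh]
    have h1 : Real.arcosh y ≤ 1 / n := by
      have := (hy2.trans hcosh)
      rw [← Real.cosh_arcosh hy1, Real.cosh_le_cosh, abs_of_nonneg (Real.arcosh_nonneg hy1),
        abs_of_nonneg (by positivity)] at this
      exact this
    have h0 := Real.arcosh_nonneg hy1
    have h2 : Real.cosh (((n:ℤ):ℝ) * Real.arcosh y) ≤ Real.cosh 1 := by
      rw [Real.cosh_le_cosh, abs_of_nonneg (by push_cast; positivity), abs_one]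
      push_cast
      calc (n:ℝ) * Real.arcosh y ≤ n * (1 / n) := by gcongr
        _ = 1 := by field_simp
    have h3 : Real.cosh 1 ≤ 3 := by
      rw [Real.cosh_eq]
      have := Real.exp_one_lt_d9
      have : Real.exp (-1) ≤ 1 := Real.exp_le_one_iff.2 (by norm_num)
      linarith
    linarith
  have key : ∀ σ : ℝ, |σ| = 1 → σ * P.eval x ≤ 3 * M := by
    intro σ hσ
    let Q : ℝ[X] := C (σ / M) * P.comp (C ((b + c) / 2) - C ((b - c) / 2) * X)
    have hQe : ∀ z, Q.eval z = σ / M * P.eval ((b + c) / 2 - (b - c) / 2 * z) := by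
      intro z; simp [Q]
    have hQd : Q.degree ≤ (n : ℕ) := by
      refine natDegree_le_iff_degree_le.1 ?_
      refine (natDegree_C_mul_le _ _).trans ?_
      refine natDegree_comp_le.trans ?_
      have h1 : P.natDegree ≤ n := natDegree_le_iff_degree_le.2 hP
      have h2 : (C ((b + c) / 2) - C ((b - c) / 2) * X : ℝ[X]).natDegree ≤ 1 := by
        compute_degree
      calc _ ≤ n * 1 := Nat.mul_le_mul h1 h2
        _ = n := by simp
    have hQb : ∀ z ∈ Set.Icc (-1:ℝ) 1, |Q.eval z| ≤ 1 := by
      intro z hz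
      rw [hQe, abs_mul, abs_div, hσ, abs_of_pos hM, one_div, inv_mul_le_iff₀ hM, mul_one]
      apply hb
      constructor <;> nlinarith [hz.1, hz.2]
    have := Chebyshev.eval_iterate_derivative_le_of_forall_abs_le_one (k := 0) hy1 hQd hQb
    simp only [Function.iterate_zero, id] at this
    rw [hQe, hyx] at this
    have h3 := this.trans hT
    rw [div_mul_eq_mul_div, div_le_iff₀ hM] at h3
    exact h3
  have k1 := key 1 (by simp)
  have k2 := key (-1) (by simp)
  exact abs_le.2 ⟨by linarith, by linarith⟩

open Polynomial in
lemma aux_cs (P : ℝ[X]) (a b t : ℝ) (hat : a < t) (htb : t < b) :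
    (P.eval b - P.eval t) ^ 2 ≤
      Real.log ((b - a) / (t - a)) * ∫ s in a..b, (P.derivative.eval s) ^ 2 * (s - a) := by
  have hF : ∫ s in t..b, P.derivative.eval s = P.eval b - P.eval t := by
    apply intervalIntegral.integral_eq_sub_of_hasDerivAt
    · intro x _; exact P.hasDerivAt x
    · exact P.derivative.continuous.intervalIntegrable _ _
  have hL : ∫ s in t..b, (s - a)⁻¹ = Real.log ((b - a) / (t - a)) := by
    rw [intervalIntegral.integral_comp_sub_right (fun s => s⁻¹) a,
      integral_inv_of_pos (by linarith) (by linarith)]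
  have hLpos : 0 < Real.log ((b - a) / (t - a)) := by
    apply Real.log_pos
    rw [one_lt_div (by linarith)]; linarith
  have hJc : Continuous (fun s => (P.derivative.eval s) ^ 2 * (s - a)) := by
    have := P.derivative.continuous
    fun_prop
  have hJ : ∫ s in t..b, (P.derivative.eval s) ^ 2 * (s - a) ≤
      ∫ s in a..b, (P.derivative.eval s) ^ 2 * (s - a) := by
    rw [← intervalIntegral.integral_add_adjacent_intervals (hJc.intervalIntegrable a t)
      (hJc.intervalIntegrable t b)]
    have : 0 ≤ ∫ s in a..t, (P.derivative.eval s) ^ 2 * (s - a) := by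
      apply intervalIntegral.integral_nonneg hat.le
      intro u hu
      exact mul_nonneg (sq_nonneg _) (by linarith [hu.1])
    linarith
  have hLi : IntervalIntegrable (fun s => (s - a)⁻¹) MeasureTheory.volume t b := by
    apply ContinuousOn.intervalIntegrable
    apply ContinuousOn.inv₀ (by fun_prop)
    intro x hx
    rw [Set.uIcc_of_le htb.le] at hx
    have := hx.1
    exact ne_of_gt (by linarith)
  set L := Real.log ((b - a) / (t - a))
  set F := P.eval b - P.eval t
  have hq : ∀ κ : ℝ, 0 ≤ (∫ s in t..b, (P.derivative.eval s) ^ 2 * (s - a)) - 2 * κ * F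
      + κ ^ 2 * L := by
    intro κ
    rw [← hF, ← hL, ← intervalIntegral.integral_const_mul, ← intervalIntegral.integral_const_mul,
      ← intervalIntegral.integral_sub (hJc.intervalIntegrable _ _)
        ((P.derivative.continuous.intervalIntegrable _ _).const_mul _),
      ← intervalIntegral.integral_add ((hJc.intervalIntegrable _ _).sub
        ((P.derivative.continuous.intervalIntegrable _ _).const_mul _)) (hLi.const_mul _)]
    apply intervalIntegral.integral_nonneg htb.le
    intro s hs
    have hs0 : 0 < s - a := by linarith [hs.1]
    have : (P.derivative.eval s) ^ 2 * (s - a) - 2 * κ * P.derivative.eval s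
        + κ ^ 2 * (s - a)⁻¹ = (s - a) * (P.derivative.eval s - κ * (s - a)⁻¹) ^ 2 := by
      field_simp
      ring
    rw [this]; positivity
  have h1 := hq (F / L)
  have h2 : F ^ 2 ≤ L * ∫ s in t..b, (P.derivative.eval s) ^ 2 * (s - a) := by
    have : 2 * (F / L) * F - (F / L) ^ 2 * L = F ^ 2 / L := by field_simp; ring
    have h3 : F ^ 2 / L ≤ ∫ s in t..b, (P.derivative.eval s) ^ 2 * (s - a) := by linarith
    rw [div_le_iff₀ hLpos] at h3
    linarith
  exact h2.trans (by gcongr)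

open Polynomial in
lemma aux_scalar (P : ℝ[X]) (r : ℕ) (hP : P.degree ≤ (r : ℕ)) (a b t : ℝ) (hab : a < b)
    (ht : t ∈ Set.Ioo a b) :
    (P.eval t) ^ 2 ≤ 90 * Real.log (r + 1) * (∫ s in a..b, (P.derivative.eval s) ^ 2 * (s - a))
      + 90 * (P.eval b) ^ 2 := by
  rcases Nat.eq_zero_or_pos r with rfl | hr
  · rw [eq_C_of_degree_le_zero (p := P) (by simpa using hP)]
    simp
    nlinarith [sq_nonneg (P.coeff 0)]
  have hr1 : (1:ℝ) ≤ r := by exact_mod_cast hr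
  set J := ∫ s in a..b, (P.derivative.eval s) ^ 2 * (s - a) with hJdef
  have hJ : 0 ≤ J := by
    apply intervalIntegral.integral_nonneg hab.le
    intro u hu
    exact mul_nonneg (sq_nonneg _) (by linarith [hu.1])
  have hlog : 0 ≤ Real.log (r + 1) := Real.log_nonneg (by linarith)
  obtain ⟨c, hc⟩ : ∃ c : ℝ, c = a + (b - a) / (8 * (r:ℝ)^2) := ⟨_, rfl⟩
  have hca : 0 < c - a := by
    rw [hc, add_sub_cancel_left]; exact div_pos (sub_pos.2 hab) (by positivity)
  obtain ⟨B, hB⟩ : ∃ B : ℝ, B = 10 * Real.log (r + 1) * J + 2 * (P.eval b) ^ 2 := ⟨_, rfl⟩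
  have hB0 : 0 ≤ B := by rw [hB]; positivity
  have hmain : ∀ s ∈ Set.Icc c b, (P.eval s) ^ 2 ≤ B := by
    intro s hs
    rcases hs.2.eq_or_lt with h | h
    · subst h
      rw [hB]
      have : 0 ≤ 10 * Real.log (r + 1) * J := by positivity
      nlinarith [sq_nonneg (P.eval s)]
    have hcs := aux_cs P a b s (by linarith [hs.1]) h
    have hl : Real.log ((b - a) / (s - a)) ≤ 5 * Real.log (r + 1) := by
      have hsa : 0 < s - a := by linarith [hs.1]
      have e5 : 5 * Real.log ((r:ℝ) + 1) = Real.log (((r:ℝ) + 1) ^ 5) := by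
        rw [Real.log_pow]; norm_num
      rw [e5]
      apply Real.log_le_log (div_pos (by linarith) hsa)
      calc (b - a) / (s - a) ≤ (b - a) / (c - a) := by
            have := hs.1
            have := sub_pos.2 hab
            gcongr
        _ = 8 * (r:ℝ)^2 := by
            have := (sub_pos.2 hab).ne'
            rw [hc]; field_simp; simp [this]
        _ ≤ ((r:ℝ) + 1)^3 * ((r:ℝ) + 1)^2 := by
            have : (8:ℝ) ≤ ((r:ℝ) + 1)^3 := by
              calc (8:ℝ) = 2 ^ 3 := by norm_num
                _ ≤ _ := by gcongr; linarith
            have : (r:ℝ)^2 ≤ ((r:ℝ) + 1)^2 := by gcongr; linarith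
            gcongr
        _ = _ := by ring
    have h5 : (P.eval b - P.eval s) ^ 2 ≤ 5 * Real.log (r + 1) * J :=
      hcs.trans (mul_le_mul_of_nonneg_right hl hJ)
    rw [hB]
    nlinarith [sq_nonneg (2 * P.eval b - P.eval s)]
  have hfin : (P.eval t) ^ 2 ≤ 9 * B := by
    rcases le_total c t with h | h
    · have := hmain t ⟨h, ht.2.le⟩
      linarith
    apply le_of_forall_pos_le_add
    intro ε hε
    have hM : 0 < Real.sqrt (B + ε / 9) := Real.sqrt_pos.2 (by positivity)
    have := aux_growth hr P hP a b c _ hab hc hM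
      (fun s hs => Real.abs_le_sqrt ((hmain s hs).trans (by linarith))) t ht.1.le h
    have h2 := pow_le_pow_left₀ (abs_nonneg _) this 2
    rw [sq_abs, mul_pow, Real.sq_sqrt (by positivity)] at h2
    linarith
  have := sq_nonneg (P.eval b)
  rw [hB] at hfin
  linarith


/-- Sup-norm bound for vector-valued polynomials on an interval
(Lemma C.2 in the paper, from Schötzau–Schwab), with a constant independent
of the degree `r`, the endpoints `a`, `b`, and the dimension `d`. -/
theorem poly_sup_bound :
    ∃ C > (0:ℝ), ∀ (a b : ℝ), a < b → ∀ (d r : ℕ) (φ : Fin d → Polynomial ℝ),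
      (∀ i, (φ i).degree ≤ (r : ℕ)) →
      ∀ t ∈ Set.Ioo a b,
        (∑ i, ((φ i).eval t) ^ 2) ≤
          C * Real.log (r + 1) *
              (∫ s in a..b, (∑ i, ((φ i).derivative.eval s) ^ 2) * (s - a)) +
            C * ∑ i, ((φ i).eval b) ^ 2 := by
  refine ⟨90, by norm_num, ?_⟩
  intro a b hab d r φ hφ t ht
  have hint : (∫ s in a..b, (∑ i, ((φ i).derivative.eval s) ^ 2) * (s - a)) =
      ∑ i, ∫ s in a..b, ((φ i).derivative.eval s) ^ 2 * (s - a) := by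
    simp_rw [Finset.sum_mul]
    apply intervalIntegral.integral_finsetSum
    intro i _
    apply Continuous.intervalIntegrable
    have := (φ i).derivative.continuous
    fun_prop
  rw [hint, Finset.mul_sum, Finset.mul_sum, ← Finset.sum_add_distrib]
  exact Finset.sum_le_sum fun i _ => aux_scalar (φ i) r (hφ i) a b t hab ht
end

section
/- Fix a bilinear form $B$ on the discontinuous Galerkin space $X_h^r$ of piecewise polynomials of degree $\le r$ on a partition $0 = t_0 < \cdots < t_N = T$ with maximal mesh size $h$, defined by $B(x,\varphi) = \sum_{n=1}^N (x',\varphi)_{I_n} + \sum_{n=2}^N ([x]_{n-1}, \varphi^+_{n-1}) + (x^+_0, \varphi^+_0)$. Suppose $x \in X_h^r$ and there is $C_0 > 0$ with $|B(x,\varphi)| \le C_0 \sum_{n=1}^N \left( |(x,\varphi)_{I_n}| + |(u,\varphi)_{I_n}| \right)$ for all $\varphi \in X_h^r$, where $u \in L^2(0,T;\mathbb{R}^d)$. Then there exists $C > 0$, independent of $h$, such that $\|x\|_{L^\infty(0,T)} \le C \|u\|_{L^2(0,T)}$ for all sufficiently small $h$. -/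
open MeasureTheory
open scoped BigOperators

/-- The DG bilinear form `B(x, φ)` on a partition `tt 0 < tt 1 < ⋯ < tt N`,
for piecewise (vector-valued) polynomials represented by their pieces:
`x n` is the polynomial describing `x` on the interval `(tt (n-1), tt n)`. -/
noncomputable def DGform (d N : ℕ) (tt : ℕ → ℝ) (x φ : ℕ → Fin d → Polynomial ℝ) : ℝ :=
  (∑ n ∈ Finset.Icc 1 N, ∫ t in tt (n - 1)..tt n,
      ∑ i, ((x n i).derivative.eval t) * (φ n i).eval t)
  + (∑ n ∈ Finset.Icc 2 N, ∑ i,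
      ((x n i).eval (tt (n - 1)) - (x (n - 1) i).eval (tt (n - 1))) * (φ n i).eval (tt (n - 1)))
  + ∑ i, (x 1 i).eval (tt 0) * (φ 1 i).eval (tt 0)

lemma poly_key0 (r : ℕ) : ∃ M > (0:ℝ), ∀ p : Polynomial ℝ, p.degree ≤ (r:ℕ) →
    ∀ t ∈ Set.Icc (0:ℝ) 1, (p.eval t)^2 ≤ M * ∫ s in (0:ℝ)..1, s * (p.eval s)^2 := by
  classical
  let P : EuclideanSpace ℝ (Fin (r+1)) → ℝ → ℝ := fun v s => ∑ j : Fin (r+1), v j * s ^ (j:ℕ)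
  have hPc : Continuous (Function.uncurry P) := by
    unfold P Function.uncurry
    fun_prop
  let Q : EuclideanSpace ℝ (Fin (r+1)) → ℝ := fun v => ∫ s in (0:ℝ)..1, s * (P v s)^2
  have hQc : Continuous Q := by
    apply intervalIntegral.continuous_parametric_intervalIntegral_of_continuous'
    unfold Function.uncurry
    unfold Function.uncurry at hPc
    fun_prop
  have hPv : ∀ v, Continuous (P v) := fun v => by
    unfold P; fun_prop
  have hQpos : ∀ v, v ≠ 0 → 0 < Q v := by
    intro v hv
    by_contra hcon
    have h0 : Q v = 0 := by
      apply le_antisymm (not_lt.mp hcon)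
      apply intervalIntegral.integral_nonneg (by norm_num)
      intro s hs
      exact mul_nonneg hs.1 (sq_nonneg _)
    apply hv
    have hz : ∀ s ∈ Set.Ioc (0:ℝ) 1, P v s = 0 := by
      intro s hs
      by_contra hne
      have : 0 < Q v := by
        apply intervalIntegral.integral_pos (by norm_num)
        · have := hPv v
          fun_prop
        · intro y hy
          exact mul_nonneg hy.1.le (sq_nonneg _)
        · exact ⟨s, ⟨hs.1.le, hs.2⟩, mul_pos hs.1 (by positivity)⟩
      linarith
    let p : Polynomial ℝ := ∑ j : Fin (r+1), Polynomial.C (v j) * Polynomial.X ^ (j:ℕ)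
    have hpe : ∀ s, p.eval s = P v s := by
      intro s
      simp [p, P, Polynomial.eval_finsetSum]
    have hp0 : p = 0 := by
      apply Polynomial.eq_zero_of_infinite_isRoot
      apply Set.Infinite.mono _ (Set.Ioc_infinite (show (0:ℝ) < 1 by norm_num))
      intro s hs
      simp only [Set.mem_ofPred_eq, Polynomial.IsRoot]
      rw [hpe, hz s hs]
    ext j
    have : p.coeff j = v j := by
      simp only [p, Polynomial.finsetSum_coeff, Polynomial.coeff_C_mul, Polynomial.coeff_X_pow]
      rw [Finset.sum_eq_single j]
      · simp
      · intro i _ hij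
        have : (j:ℕ) ≠ i := fun h => hij (Fin.ext h.symm)
        simp [this]
      · simp
    rw [← this, hp0]; simp
  have hcomp : IsCompact (Metric.sphere (0:EuclideanSpace ℝ (Fin (r+1))) 1) := isCompact_sphere _ _
  have hne : (Metric.sphere (0:EuclideanSpace ℝ (Fin (r+1))) 1).Nonempty := by
    exact NormedSpace.sphere_nonempty.mpr (by norm_num)
  obtain ⟨w, hw, hmin⟩ := hcomp.exists_isMinOn hne hQc.continuousOn
  have hc : 0 < Q w := hQpos w (by
    rintro rfl
    simp at hw)
  have hQs : ∀ (c : ℝ) v, Q (c • v) = c^2 * Q v := by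
    intro c v
    have hP : ∀ s, P (c • v) s = c * P v s := by
      intro s
      simp [P, Finset.mul_sum, mul_assoc]
    simp only [Q, hP]
    rw [← intervalIntegral.integral_const_mul]
    congr 1; ext s; ring
  have hQl : ∀ v : EuclideanSpace ℝ (Fin (r+1)), Q w * ‖v‖^2 ≤ Q v := by
    intro v
    by_cases hv : v = 0
    · subst hv
      simp [Q, P]
    · have hn : 0 < ‖v‖ := norm_pos_iff.mpr hv
      have h1 : Q w ≤ Q (‖v‖⁻¹ • v) := hmin (by
        simp [norm_smul, hn.ne'])
      rw [hQs] at h1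
      have : Q v = ‖v‖^2 * ((‖v‖⁻¹)^2 * Q v) := by field_simp
      rw [this, mul_comm]
      gcongr
  refine ⟨(r+1) / Q w, by positivity, ?_⟩
  intro p hp t ht
  let v : EuclideanSpace ℝ (Fin (r+1)) := WithLp.toLp 2 (fun j : Fin (r+1) => p.coeff j)
  have hpe : ∀ s, p.eval s = P v s := by
    intro s
    rw [Polynomial.eval_eq_sum_range' (n := r+1) (Nat.lt_succ_of_le (Polynomial.natDegree_le_of_degree_le hp))]
    simp only [P, v]
    rw [Finset.sum_range]
  have h1 : (P v t)^2 ≤ (r+1) * ‖v‖^2 := by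
    rw [EuclideanSpace.norm_sq_eq]
    have := Finset.sum_mul_sq_le_sq_mul_sq Finset.univ (fun j : Fin (r+1) => v j) (fun j => t^(j:ℕ))
    refine this.trans ?_
    rw [mul_comm]
    have h2 : ∑ i : Fin (r+1), (t ^ (i:ℕ))^2 ≤ r+1 := by
      calc _ ≤ ∑ i : Fin (r+1), (1:ℝ) := by
            apply Finset.sum_le_sum
            intro i _
            exact pow_le_one₀ (pow_nonneg ht.1 _) (pow_le_one₀ ht.1 ht.2)
        _ = _ := by simp
    simp only [Real.norm_eq_abs, sq_abs]
    gcongr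
  have h3 : ∫ s in (0:ℝ)..1, s * (p.eval s)^2 = Q v := by
    simp only [hpe, Q]
  rw [h3, hpe]
  calc _ ≤ (r+1) * ‖v‖^2 := h1
    _ = (r+1)/Q w * (Q w * ‖v‖^2) := by field_simp
    _ ≤ _ := by
      gcongr
      exact hQl v

lemma poly_key (r : ℕ) : ∃ M > (0:ℝ), ∀ p : Polynomial ℝ, p.degree ≤ (r:ℕ) → ∀ a b : ℝ, a < b →
    ∀ t ∈ Set.Icc a b, (b-a)^2 * (p.eval t)^2 ≤ M * ∫ s in a..b, (s-a) * (p.eval s)^2 := by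
  obtain ⟨M, hM, h⟩ := poly_key0 r
  refine ⟨M, hM, ?_⟩
  intro p hp a b hab t ht
  have hk : 0 < b - a := sub_pos.mpr hab
  let q := p.comp (Polynomial.C (b-a) * Polynomial.X + Polynomial.C a)
  have hq : q.degree ≤ (r:ℕ) := by
    apply Polynomial.degree_le_of_natDegree_le
    refine Polynomial.natDegree_comp_le.trans ?_
    have h1 := Polynomial.natDegree_linear_le (a := b-a) (b := a)
    have h2 := Polynomial.natDegree_le_of_degree_le hp
    nlinarith
  have := h q hq ((t-a)/(b-a)) ⟨div_nonneg (by linarith [ht.1]) hk.le, by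
    rw [div_le_one hk]; linarith [ht.2]⟩
  have he : ∀ s, q.eval s = p.eval ((b-a)*s+a) := by intro s; simp [q]
  have hi := intervalIntegral.integral_comp_mul_add (a := 0) (b := 1)
    (fun y => (y-a) * (p.eval y)^2) hk.ne' a
  simp only [he] at this
  rw [mul_div_cancel₀ _ hk.ne', sub_add_cancel] at this
  have e1 : ∫ s in (0:ℝ)..1, ((b-a)*s+a-a) * (p.eval ((b-a)*s+a))^2 = (b-a) * ∫ s in (0:ℝ)..1, s * (p.eval ((b-a)*s+a))^2 := by
    rw [← intervalIntegral.integral_const_mul]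
    congr 1; ext s; ring
  rw [e1] at hi
  simp only [mul_zero, zero_add, mul_one, sub_add_cancel, smul_eq_mul] at hi
  have e2 : ∫ s in a..b, (s-a) * (p.eval s)^2 = (b-a)^2 * ∫ s in (0:ℝ)..1, s * (p.eval ((b-a)*s+a))^2 := by
    rw [pow_two, mul_assoc, hi]; field_simp
  rw [e2, mul_left_comm]
  gcongr

lemma young {d : ℕ} (a b c : ℝ) (hab : a ≤ b) (hc : 0 < c) (f : ℝ → Fin d → ℝ)
    (p : Fin d → Polynomial ℝ)
    (hfi : IntervalIntegrable (fun t => ∑ i, (f t i)^2) volume a b) :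
    |∫ t in a..b, ∑ i, f t i * (p i).eval t| ≤
      c/2 * (∫ t in a..b, ∑ i, (f t i)^2) + 1/(2*c) * ∫ t in a..b, ∑ i, ((p i).eval t)^2 := by
  have hp : IntervalIntegrable (fun t => ∑ i, ((p i).eval t)^2) volume a b := by
    apply Continuous.intervalIntegrable; fun_prop
  rw [← intervalIntegral.integral_const_mul, ← intervalIntegral.integral_const_mul,
    ← intervalIntegral.integral_add (hfi.const_mul _) (hp.const_mul _), ← Real.norm_eq_abs]
  apply intervalIntegral.norm_integral_le_of_norm_le hab _ ((hfi.const_mul _).add (hp.const_mul _))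
  refine Filter.Eventually.of_forall fun t _ => ?_
  rw [Real.norm_eq_abs, Finset.mul_sum, Finset.mul_sum, ← Finset.sum_add_distrib]
  refine (Finset.abs_sum_le_sum_abs _ _).trans (Finset.sum_le_sum fun i _ => ?_)
  rw [abs_mul, ← sq_abs (f t i), ← sq_abs ((p i).eval t)]
  generalize |f t i| = x
  generalize |(p i).eval t| = y
  have : c/2*x^2 + 1/(2*c)*y^2 - x*y = (c*x-y)^2/(2*c) := by field_simp; ring
  have : 0 ≤ (c*x-y)^2/(2*c) := by positivity
  linarith

lemma energy (a b : ℝ) (p : Polynomial ℝ) :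
    ∫ t in a..b, p.derivative.eval t * p.eval t = ((p.eval b)^2 - (p.eval a)^2)/2 := by
  have : ∀ t ∈ Set.uIcc a b, HasDerivAt (fun t => p.eval t * p.eval t / 2) (p.derivative.eval t * p.eval t) t := by
    intro t _
    have := ((p.hasDerivAt t).fun_mul (p.hasDerivAt t)).div_const 2
    exact this.congr_deriv (by ring)
  rw [intervalIntegral.integral_eq_sub_of_hasDerivAt this]
  · ring
  · apply Continuous.intervalIntegrable; fun_prop

lemma step (d r : ℕ) (C₀ M a b : ℝ) (hC₀ : 0 < C₀) (hM : 0 < M)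
    (key : ∀ p : Polynomial ℝ, p.degree ≤ (r:ℕ) → ∀ a b : ℝ, a < b →
    ∀ t ∈ Set.Icc a b, (b-a)^2 * (p.eval t)^2 ≤ M * ∫ s in a..b, (s-a) * (p.eval s)^2)
    (hab : a < b) (p : Fin d → Polynomial ℝ) (hp : ∀ i, (p i).degree ≤ (r:ℕ))
    (q : Fin d → ℝ) (u : ℝ → Fin d → ℝ)
    (hu : IntervalIntegrable (fun t => ∑ i, (u t i)^2) volume a b)
    (hk1 : 8 * M * C₀^2 * (b-a)^2 ≤ 1) (hk2 : 24 * C₀ * (b-a) ≤ 1)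
    (H : ∀ ψ : Fin d → Polynomial ℝ, (∀ i, (ψ i).degree ≤ (r:ℕ)) →
      |(∫ t in a..b, ∑ i, (p i).derivative.eval t * (ψ i).eval t)
        + ∑ i, ((p i).eval a - q i) * (ψ i).eval a| ≤
      C₀ * (|∫ t in a..b, ∑ i, (p i).eval t * (ψ i).eval t| +
        |∫ t in a..b, ∑ i, u t i * (ψ i).eval t|)) :
    (∑ i, ((p i).eval b)^2 ≤ (1 + 24 * C₀ * (b-a)) *
      (∑ i, (q i)^2 + 4 * C₀ * ∫ t in a..b, ∑ i, (u t i)^2)) ∧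
    ∀ t ∈ Set.Icc a b, ∑ i, ((p i).eval t)^2 ≤ 4 * ∑ i, ((p i).eval b)^2
      + 8 * M * C₀^2 * (b-a) * ∫ t in a..b, ∑ i, (u t i)^2 := by
  have hk : 0 < b - a := sub_pos.mpr hab
  have hxi : IntervalIntegrable (fun t => ∑ i, ((p i).eval t)^2) volume a b := by
    apply Continuous.intervalIntegrable; fun_prop
  set k := b - a with hkdef
  set U := ∫ t in a..b, ∑ i, (u t i)^2 with hU
  set X := ∫ t in a..b, ∑ i, ((p i).eval t)^2 with hX
  set B := ∑ i, ((p i).eval b)^2 with hB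
  set A := ∑ i, (q i)^2 with hA
  have hU0 : 0 ≤ U := intervalIntegral.integral_nonneg hab.le fun t _ =>
    Finset.sum_nonneg fun i _ => sq_nonneg _
  have hX0 : 0 ≤ X := intervalIntegral.integral_nonneg hab.le fun t _ =>
    Finset.sum_nonneg fun i _ => sq_nonneg _
  have hB0 : 0 ≤ B := Finset.sum_nonneg fun i _ => sq_nonneg _
  have hA0 : 0 ≤ A := Finset.sum_nonneg fun i _ => sq_nonneg _
  have hdeg : ∀ i, (p i).derivative.degree ≤ (r:ℕ) := fun i =>
    (Polynomial.degree_derivative_le).trans (hp i)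
  -- weighted derivative bound
  set W : Fin d → ℝ := fun i => ∫ s in a..b, (s-a) * ((p i).derivative.eval s)^2 with hW
  have hWsum : ∑ i, W i = ∫ s in a..b, ∑ i, (s-a) * ((p i).derivative.eval s)^2 := by
    rw [intervalIntegral.integral_finsetSum]
    intro i _
    apply Continuous.intervalIntegrable; fun_prop
  have hWb : ∑ i, W i ≤ 2 * C₀^2 * k * (X + U) := by
    let ψ : Fin d → Polynomial ℝ := fun i => (Polynomial.X - Polynomial.C a) * (p i).derivative
    have hψd : ∀ i, (ψ i).degree ≤ (r:ℕ) := by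
      intro i
      apply Polynomial.degree_le_of_natDegree_le
      by_cases h0 : (p i).natDegree = 0
      · have : (p i).derivative = 0 := Polynomial.derivative_of_natDegree_zero h0
        simp [ψ, this]
      · have h1 := Polynomial.natDegree_derivative_lt h0
        have h2 := Polynomial.natDegree_le_of_degree_le (hp i)
        have h3 : (ψ i).natDegree ≤ _ := Polynomial.natDegree_mul_le
        rw [Polynomial.natDegree_X_sub_C] at h3
        omega
    have hψe : ∀ i s, (ψ i).eval s = (s-a) * (p i).derivative.eval s := by intro i s; simp [ψ]
    have h1 := H ψ hψd
    have e1 : (∫ t in a..b, ∑ i, (p i).derivative.eval t * (ψ i).eval t)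
        + ∑ i, ((p i).eval a - q i) * (ψ i).eval a = ∑ i, W i := by
      rw [hWsum]
      simp only [hψe]
      simp only [sub_self, zero_mul, mul_zero, Finset.sum_const_zero, add_zero]
      congr 1; ext t; apply Finset.sum_congr rfl; intro i _; ring
    rw [e1] at h1
    have hc : 0 < 2 * C₀ * k := by positivity
    have y1 := young a b (2*C₀*k) hab.le hc (fun t i => (p i).eval t) ψ hxi
    have y2 := young a b (2*C₀*k) hab.le hc u ψ hu
    rw [← hX] at y1
    rw [← hU] at y2
    have h2 : ∫ t in a..b, ∑ i, ((ψ i).eval t)^2 ≤ k * ∑ i, W i := by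
      rw [hWsum, ← intervalIntegral.integral_const_mul]
      apply intervalIntegral.integral_mono_on hab.le
      · apply Continuous.intervalIntegrable; fun_prop
      · apply Continuous.intervalIntegrable; fun_prop
      · intro t ht
        rw [Finset.mul_sum]
        apply Finset.sum_le_sum
        intro i _
        rw [hψe, mul_pow, ← mul_assoc]
        have : (t-a)^2 ≤ k * (t-a) := by
          have := ht.1
          have := ht.2
          nlinarith
        gcongr
    set Ψ := ∫ t in a..b, ∑ i, ((ψ i).eval t)^2
    have h3 := (le_abs_self _).trans h1
    have h4 : ∑ i, W i ≤ C₀ * ((2*C₀*k/2 * X + 1/(2*(2*C₀*k)) * Ψ) + (2*C₀*k/2 * U + 1/(2*(2*C₀*k)) * Ψ)) := by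
      refine h3.trans ?_
      gcongr
    have h5 : C₀ * ((2*C₀*k/2 * X + 1/(2*(2*C₀*k)) * Ψ) + (2*C₀*k/2 * U + 1/(2*(2*C₀*k)) * Ψ))
      = C₀^2*k*(X+U) + Ψ/(2*k) := by field_simp; ring
    have h6 : Ψ/(2*k) ≤ (∑ i, W i)/2 := by
      rw [div_le_div_iff₀ (by positivity) (by norm_num)]; linarith
    linarith
  -- pointwise bound
  have hpt : ∀ t ∈ Set.Icc a b, ∑ i, ((p i).eval t)^2 ≤ 2 * B + 4 * M * C₀^2 * k * (X+U) := by
    intro t ht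
    have : ∀ i, ((p i).eval t)^2 ≤ 2 * ((p i).eval b)^2 + 2 * (M * W i) := by
      intro i
      have h1 : ((p i).eval b - (p i).eval t)^2 ≤ M * W i := by
        rcases eq_or_lt_of_le ht.2 with h | h
        · rw [h, sub_self]
          have := key _ (hdeg i) a b hab a ⟨le_rfl, hab.le⟩
          have h' : 0 ≤ k^2 * ((p i).derivative.eval a)^2 := by positivity
          calc _ = (0:ℝ) := by norm_num
            _ ≤ _ := h'
            _ ≤ _ := this
        · obtain ⟨ξ, hξ, he⟩ := exists_hasDerivAt_eq_slope (fun s => (p i).eval s)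
            (fun s => (p i).derivative.eval s) h (by fun_prop) (fun s _ => (p i).hasDerivAt s)
          have := key _ (hdeg i) a b hab ξ ⟨ht.1.trans hξ.1.le, hξ.2.le⟩
          refine le_trans ?_ this
          have hbt : 0 < b - t := sub_pos.mpr h
          have : (p i).eval b - (p i).eval t = (p i).derivative.eval ξ * (b-t) := by
            rw [he]; field_simp
          rw [this, mul_pow, mul_comm]
          gcongr
          exact ht.1
      nlinarith [sq_nonneg (2 * (p i).eval b - (p i).eval t)]
    calc _ ≤ ∑ i, (2 * ((p i).eval b)^2 + 2 * (M * W i)) := Finset.sum_le_sum fun i _ => this i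
      _ = 2 * B + 2 * M * ∑ i, W i := by
        rw [Finset.sum_add_distrib, ← Finset.mul_sum, ← Finset.mul_sum, ← Finset.mul_sum, mul_assoc]
      _ ≤ 2 * B + 2 * M * (2 * C₀^2 * k * (X + U)) := by gcongr
      _ = _ := by ring
  have hX1 : X ≤ k * (2 * B + 4 * M * C₀^2 * k * (X+U)) := by
    have : X ≤ ∫ t in a..b, (2 * B + 4 * M * C₀^2 * k * (X+U)) := by
      apply intervalIntegral.integral_mono_on hab.le hxi (by simp) hpt
    rw [intervalIntegral.integral_const, smul_eq_mul] at this
    exact this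
  have hX2 : X ≤ 4 * k * B + U := by
    have : 8 * M * C₀^2 * k^2 * (X+U) ≤ 1 * (X+U) := by gcongr
    nlinarith
  constructor
  · have h1 := H p hp
    have e1 : (∫ t in a..b, ∑ i, (p i).derivative.eval t * (p i).eval t)
        + ∑ i, ((p i).eval a - q i) * (p i).eval a
        = B/2 - A/2 + (∑ i, ((p i).eval a - q i)^2)/2 := by
      rw [intervalIntegral.integral_finsetSum]
      · simp only [energy, hA, hB, Finset.sum_div, ← Finset.sum_add_distrib, ← Finset.sum_sub_distrib]
        apply Finset.sum_congr rfl; intro i _; ring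
      · intro i _
        apply Continuous.intervalIntegrable; fun_prop
    rw [e1] at h1
    have h2 : 0 ≤ ∑ i, ((p i).eval a - q i)^2 := Finset.sum_nonneg fun i _ => sq_nonneg _
    have y2 := young a b 1 hab.le one_pos u p hu
    have e2 : ∫ t in a..b, ∑ i, (p i).eval t * (p i).eval t = X := by
      rw [hX]; congr 1; ext t; apply Finset.sum_congr rfl; intro i _; ring
    rw [e2, abs_of_nonneg hX0] at h1
    rw [← hX, ← hU] at y2
    have h3 := (le_abs_self _).trans h1
    have h4 : C₀ * (X + |∫ t in a..b, ∑ i, u t i * (p i).eval t|) ≤ C₀ * (X + (1/2 * U + 1/(2*1) * X)) := by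
      gcongr
    have h5 : C₀ * X ≤ C₀ * (4 * k * B + U) := by gcongr
    have h6 : B ≤ A + 12 * C₀ * k * B + 4 * C₀ * U := by nlinarith
    have h7 : 0 ≤ A + 4 * C₀ * U := by positivity
    set y := 12 * C₀ * k with hy
    have hy0 : 0 ≤ y := by positivity
    have hy1 : y ≤ 1/2 := by rw [hy]; linarith
    have h8 : (1 - y) * B ≤ A + 4 * C₀ * U := by linarith
    have h9 : B ≤ (1 + 2*y) * ((1-y)*B) := by nlinarith [mul_nonneg (mul_nonneg hy0 (by linarith : 0 ≤ 1 - 2*y)) hB0]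
    calc B ≤ (1 + 2*y) * ((1-y)*B) := h9
      _ ≤ (1+2*y) * (A + 4 * C₀ * U) := by gcongr
      _ = _ := by rw [hy]; ring
  · intro t ht
    refine (hpt t ht).trans ?_
    have h1 : 4 * M * C₀^2 * k * (X+U) ≤ 4 * M * C₀^2 * k * ((4 * k * B + U)+U) := by gcongr
    have h2 : 8 * M * C₀^2 * k^2 * B ≤ 1 * B := by gcongr
    have h3 : 4 * M * C₀^2 * k * ((4 * k * B + U)+U) =
      2 * (8 * M * C₀^2 * k^2 * B) + 8 * M * C₀^2 * k * U := by ring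
    linarith

/-- left trace -/
noncomputable def dgPrev (d : ℕ) (tt : ℕ → ℝ) (x : ℕ → Fin d → Polynomial ℝ) (m : ℕ) (i : Fin d) : ℝ :=
  if m = 0 then 0 else (x m i).eval (tt m)

lemma DG_local (d r N : ℕ) (tt : ℕ → ℝ) (C₀ : ℝ) (x : ℕ → Fin d → Polynomial ℝ) (u : ℝ → Fin d → ℝ)
    (H : ∀ φ : ℕ → Fin d → Polynomial ℝ, (∀ n i, (φ n i).degree ≤ (r : ℕ)) →
            |DGform d N tt x φ| ≤
              C₀ * ∑ n ∈ Finset.Icc 1 N,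
                (|∫ t in tt (n - 1)..tt n, ∑ i, (x n i).eval t * (φ n i).eval t| +
                 |∫ t in tt (n - 1)..tt n, ∑ i, u t i * (φ n i).eval t|))
    (m : ℕ) (hm : m < N) (ψ : Fin d → Polynomial ℝ) (hψ : ∀ i, (ψ i).degree ≤ (r:ℕ)) :
      |(∫ t in tt m..tt (m+1), ∑ i, (x (m+1) i).derivative.eval t * (ψ i).eval t)
        + ∑ i, ((x (m+1) i).eval (tt m) - dgPrev d tt x m i) * (ψ i).eval (tt m)| ≤
      C₀ * (|∫ t in tt m..tt (m+1), ∑ i, (x (m+1) i).eval t * (ψ i).eval t| +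
        |∫ t in tt m..tt (m+1), ∑ i, u t i * (ψ i).eval t|) := by
  let φ : ℕ → Fin d → Polynomial ℝ := fun n => if n = m+1 then ψ else 0
  have hφd : ∀ n i, (φ n i).degree ≤ (r : ℕ) := by
    intro n i
    by_cases h : n = m+1
    · simp [φ, h, hψ]
    · simp [φ, h]
  have hφm : φ (m+1) = ψ := by simp [φ]
  have hφn : ∀ n, n ≠ m+1 → φ n = 0 := by intro n h; simp [φ, h]
  have h1 := H φ hφd
  have hmem : m+1 ∈ Finset.Icc 1 N := by simp; omega
  rw [Finset.sum_eq_single_of_mem (m+1) hmem] at h1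
  swap
  · intro n _ hn
    simp [hφn n hn]
  rw [hφm, Nat.add_sub_cancel] at h1
  convert h1 using 2
  unfold DGform
  rw [Finset.sum_eq_single_of_mem (m+1) hmem]
  swap
  · intro n _ hn
    simp [hφn n hn]
  rw [hφm, Nat.add_sub_cancel, add_assoc]
  congr 1
  by_cases h0 : m = 0
  · subst h0
    rw [Finset.sum_eq_zero (s := Finset.Icc 2 N)]
    · rw [zero_add] at hφm
      simp [dgPrev, hφm]
    · intro n hn
      have : n ≠ 0 + 1 := by simp at hn; omega
      simp [hφn n this]
  · rw [Finset.sum_eq_single_of_mem (m+1) (by simp; omega)]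
    · rw [hφm, hφn 1 (by omega)]
      simp [dgPrev, h0]
    · intro n _ hn
      simp [hφn n hn]

/-- Grönwall-type stability estimate for the DG discretization of ODEs with
input `u` (Lemma C.4): if `|B(x, φ)| ≤ C₀ ∑ₙ (|(x,φ)_{Iₙ}| + |(u,φ)_{Iₙ}|)` for
all test functions `φ` of degree `≤ r`, then `‖x‖_{L^∞} ≤ C ‖u‖_{L²}` with a
constant `C` independent of the mesh, for all sufficiently small mesh sizes. -/
theorem DG_gronwall_stability (d r : ℕ) (T C₀ : ℝ) (hT : 0 < T) (hC₀ : 0 < C₀) :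
    ∃ C > (0:ℝ), ∃ h₀ > (0:ℝ),
      ∀ (N : ℕ) (tt : ℕ → ℝ), 1 ≤ N → tt 0 = 0 → tt N = T →
        (∀ n < N, tt n < tt (n + 1)) →
        (∀ n < N, tt (n + 1) - tt n ≤ h₀) →
        ∀ (x : ℕ → Fin d → Polynomial ℝ) (u : ℝ → Fin d → ℝ),
          (∀ n i, (x n i).degree ≤ (r : ℕ)) →
          Measurable u →
          IntegrableOn (fun t => ∑ i, (u t i) ^ 2) (Set.Ioc 0 T) →
          (∀ φ : ℕ → Fin d → Polynomial ℝ, (∀ n i, (φ n i).degree ≤ (r : ℕ)) →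
            |DGform d N tt x φ| ≤
              C₀ * ∑ n ∈ Finset.Icc 1 N,
                (|∫ t in tt (n - 1)..tt n, ∑ i, (x n i).eval t * (φ n i).eval t| +
                 |∫ t in tt (n - 1)..tt n, ∑ i, u t i * (φ n i).eval t|)) →
          ∀ n ∈ Finset.Icc 1 N, ∀ t ∈ Set.Icc (tt (n - 1)) (tt n),
            (∑ i, ((x n i).eval t) ^ 2) ≤ C ^ 2 * ∫ s in (0:ℝ)..T, ∑ i, (u s i) ^ 2 := by
  obtain ⟨M, hM, key⟩ := poly_key r
  set K : ℝ := 4 * (Real.exp (24 * C₀ * T) * (4 * C₀)) + 8 * M * C₀^2 * T with hK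
  have hK0 : 0 < K := by positivity
  refine ⟨Real.sqrt K, Real.sqrt_pos.mpr hK0, min (1 / (24 * C₀)) (1 / Real.sqrt (8 * M * C₀^2)),
    by positivity, ?_⟩
  intro N tt hN ht0 htN hlt hmesh x u hx hum hui H
  rw [Real.sq_sqrt hK0.le]
  have hloc := DG_local d r N tt C₀ x u H
  set F : ℝ → ℝ := fun t => ∑ i, (u t i)^2 with hF
  have hF0 : ∀ t, 0 ≤ F t := fun t => Finset.sum_nonneg fun i _ => sq_nonneg _
  have hmono : ∀ m n, m ≤ n → n ≤ N → tt m ≤ tt n := by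
    intro m n hmn
    induction n, hmn using Nat.le_induction with
    | base => intro _; exact le_rfl
    | succ n _ ih => intro h; exact (ih (by omega)).trans (hlt n (by omega)).le
  have hT' : IntervalIntegrable F volume 0 T := by
    rw [intervalIntegrable_iff_integrableOn_Ioc_of_le hT.le]; exact hui
  have hsub : ∀ m n, m ≤ n → n ≤ N → IntervalIntegrable F volume (tt m) (tt n) := by
    intro m n hmn hn
    apply hT'.mono_set
    rw [Set.uIcc_of_le (hmono m n hmn hn), Set.uIcc_of_le hT.le]
    apply Set.Icc_subset_Icc
    · rw [← ht0]; exact hmono 0 m (by omega) (by omega)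
    · rw [← htN]; exact hmono n N hn le_rfl
  have hstep : ∀ m (hm : m < N), _ := fun m hm =>
    step d r C₀ M (tt m) (tt (m+1)) hC₀ hM key (hlt m hm) (x (m+1)) (hx (m+1))
      (dgPrev d tt x m) u (hsub m (m+1) (by omega) hm) (by
        have h1 := (hmesh m hm).trans (min_le_right _ _)
        have h2 : (tt (m+1) - tt m)^2 ≤ (1 / Real.sqrt (8 * M * C₀^2))^2 := by
          have := sub_pos.mpr (hlt m hm)
          gcongr
        rw [div_pow, Real.sq_sqrt (by positivity)] at h2
        rw [le_div_iff₀ (by positivity)] at h2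
        linarith) (by
        have h1 := (hmesh m hm).trans (min_le_left _ _)
        rw [le_div_iff₀ (by positivity)] at h1
        linarith) (hloc m hm)
  have hgron : ∀ m, m ≤ N → ∑ i, (dgPrev d tt x m i)^2 ≤
      Real.exp (24 * C₀ * tt m) * (4 * C₀ * ∫ s in (0:ℝ)..tt m, F s) := by
    intro m
    induction m with
    | zero => intro _; simp [dgPrev, ht0]
    | succ m ih =>
      intro hm
      have ih := ih (by omega)
      have h1 := (hstep m hm).1
      have e : ∑ i, (dgPrev d tt x (m+1) i)^2 = ∑ i, ((x (m+1) i).eval (tt (m+1)))^2 := by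
        simp [dgPrev]
      rw [e]
      refine h1.trans ?_
      have hadd : (∫ s in (0:ℝ)..tt m, F s) + ∫ s in tt m..tt (m+1), F s = ∫ s in (0:ℝ)..tt (m+1), F s := by
        apply intervalIntegral.integral_add_adjacent_intervals
        · rw [← ht0]; exact hsub 0 m (by omega) (by omega)
        · exact hsub m (m+1) (by omega) hm
      have hm0 : 0 ≤ tt m := by rw [← ht0]; exact hmono 0 m (by omega) (by omega)
      have hI : 0 ≤ ∫ s in tt m..tt (m+1), F s :=
        intervalIntegral.integral_nonneg (hlt m hm).le fun t _ => hF0 t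
      have hk := sub_pos.mpr (hlt m hm)
      have hex : 1 + 24 * C₀ * (tt (m+1) - tt m) ≤ Real.exp (24 * C₀ * (tt (m+1) - tt m)) := by
        rw [add_comm]; exact Real.add_one_le_exp _
      have hex1 : 1 ≤ Real.exp (24 * C₀ * tt m) := Real.one_le_exp (by positivity)
      have hA0 : 0 ≤ ∑ i, (dgPrev d tt x m i)^2 := Finset.sum_nonneg fun i _ => sq_nonneg _
      calc _ ≤ Real.exp (24 * C₀ * (tt (m+1) - tt m)) *
            (Real.exp (24 * C₀ * tt m) * (4 * C₀ * ∫ s in (0:ℝ)..tt m, F s)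
              + Real.exp (24 * C₀ * tt m) * (4 * C₀ * ∫ s in tt m..tt (m+1), F s)) := by
            have hq := le_mul_of_one_le_left
              (show 0 ≤ 4 * C₀ * ∫ s in tt m..tt (m+1), F s by positivity) hex1
            exact mul_le_mul hex (add_le_add ih hq) (by positivity) (by positivity)
        _ = Real.exp (24 * C₀ * (tt (m+1) - tt m)) * Real.exp (24 * C₀ * tt m) *
            (4 * C₀ * ((∫ s in (0:ℝ)..tt m, F s) + ∫ s in tt m..tt (m+1), F s)) := by ring
        _ = _ := by
            rw [hadd, ← Real.exp_add]; congr 2; ring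
  intro n hn t ht
  obtain ⟨m, rfl⟩ : ∃ m, n = m+1 := ⟨n-1, by simp at hn; omega⟩
  rw [Nat.add_sub_cancel] at ht
  have hm : m < N := by simp at hn; omega
  have hIle : ∀ a b, 0 ≤ a → a ≤ b → b ≤ T → ∫ s in a..b, F s ≤ ∫ s in (0:ℝ)..T, F s := by
    intro a b ha hab hb
    exact intervalIntegral.integral_mono_interval ha hab hb
      (Filter.Eventually.of_forall hF0) hT'
  have hm0 : 0 ≤ tt m := by rw [← ht0]; exact hmono 0 m (by omega) (by omega)
  have hmT : tt (m+1) ≤ T := by rw [← htN]; exact hmono (m+1) N hm le_rfl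
  have hl := hlt m hm
  have hT0 : 0 ≤ ∫ s in (0:ℝ)..T, F s := intervalIntegral.integral_nonneg hT.le fun t _ => hF0 t
  have h1 := (hstep m hm).2 t ht
  have h2 := hgron (m+1) hm
  have e : ∑ i, (dgPrev d tt x (m+1) i)^2 = ∑ i, ((x (m+1) i).eval (tt (m+1)))^2 := by
    simp [dgPrev]
  rw [e] at h2
  have h3 : ∑ i, ((x (m+1) i).eval (tt (m+1)))^2 ≤
      Real.exp (24 * C₀ * T) * (4 * C₀ * ∫ s in (0:ℝ)..T, F s) := by
    refine h2.trans ?_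
    have := hIle 0 (tt (m+1)) le_rfl (by linarith) hmT
    gcongr
    exact mul_nonneg (by positivity) (intervalIntegral.integral_nonneg (by linarith) fun t _ => hF0 t)
  have h4 : 8 * M * C₀^2 * (tt (m+1) - tt m) * ∫ s in tt m..tt (m+1), F s ≤
      8 * M * C₀^2 * T * ∫ s in (0:ℝ)..T, F s := by
    have h5 := hIle _ _ hm0 hl.le hmT
    have : 0 ≤ ∫ s in tt m..tt (m+1), F s :=
        intervalIntegral.integral_nonneg hl.le fun t _ => hF0 t
    have h6 : tt (m+1) - tt m ≤ T := by linarith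
    gcongr
  calc _ ≤ _ := h1
    _ ≤ 4 * (Real.exp (24 * C₀ * T) * (4 * C₀ * ∫ s in (0:ℝ)..T, F s)) +
        8 * M * C₀^2 * T * ∫ s in (0:ℝ)..T, F s := by gcongr
    _ = _ := by rw [hK]; ring
end
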